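/- Let r ∈ ℕ, let γ_1, …, γ_r ∈ K, and let v be a place of K. Assume that ĥ_v(γ_1) > q^{−d}·max_{i>1} ĥ_v(γ_i) (in particular ĥ_v(γ_1) > 0). Then there exist n_0 ∈ ℕ (depending only on Φ, v, and γ_1, …, γ_r) and a positive real number c_1 (depending only on Φ and v) such that for all nonzero polynomials P_1, …, P_r ∈ F_q[t] satisfying (i) deg P_1 > max{deg P_2, …, deg P_r}, (ii) min{deg P_2, …, deg P_r} ≥ n_0, and deg P_1 ≥ n_0, one has log|Φ_{P_1}(γ_1) + ⋯ + Φ_{P_r}(γ_r)|_v > c_1·q^{d·(deg P_1 − n_0)}. -/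

import Mathlib

open Polynomial Filter Topology

/-- A family of nonarchimedean places on a field `K`, with absolute values normalized so that
every nonzero `x` satisfies `|x|_v = 1` for all but finitely many places and the product
formula holds. -/
structure PlaceFamily (K : Type) [Field K] where
  Places : Type
  absv : Places → AbsoluteValue K ℝ
  nonarch : ∀ (v : Places) (x y : K), absv v (x + y) ≤ max (absv v x) (absv v y)
  finite_ne_one : ∀ x : K, x ≠ 0 → {v : Places | absv v x ≠ 1}.Finite
  product_formula : ∀ x : K, x ≠ 0 → ∏ᶠ v : Places, absv v x = 1

/-- A Drinfeld module of generic characteristic over `K`: an `𝔽_q`-algebra homomorphism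
`Φ : 𝔽_q[t] → K{τ}`, where an element `Σ b_i τ^i` of the twisted polynomial ring `K{τ}` is
recorded as the additive polynomial `Σ b_i X^{q^i} ∈ K[X]` (composition of polynomials
corresponding to multiplication in `K{τ}`); the coefficient of `τ^0` in `Φ_a` equals `a`
(via the embedding `𝔽_q[t] → K`), and `Φ_t ≠ t·τ^0`. -/
structure DrinfeldModule (Fq K : Type) [Field Fq] [Fintype Fq] [Field K]
    [Algebra (Polynomial Fq) K] where
  toFun : Polynomial Fq → Polynomial K
  map_add' : ∀ a b : Polynomial Fq, toFun (a + b) = toFun a + toFun b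
  map_mul' : ∀ a b : Polynomial Fq, toFun (a * b) = (toFun a).comp (toFun b)
  map_C' : ∀ c : Fq, toFun (Polynomial.C c) =
    Polynomial.C (algebraMap (Polynomial Fq) K (Polynomial.C c)) * Polynomial.X
  coeff_one' : ∀ a : Polynomial Fq, (toFun a).coeff 1 = algebraMap (Polynomial Fq) K a
  support_pow' : ∀ (a : Polynomial Fq) (n : ℕ), (toFun a).coeff n ≠ 0 →
    ∃ i : ℕ, n = (Fintype.card Fq) ^ i
  generic' : toFun Polynomial.X ≠
    Polynomial.C (algebraMap (Polynomial Fq) K Polynomial.X) * Polynomial.X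

namespace DrinfeldModule

variable {Fq K : Type} [Field Fq] [Fintype Fq] [Field K] [Algebra (Polynomial Fq) K]

/-- The action `Φ_a(x)` of `a ∈ 𝔽_q[t]` on `x ∈ 𝔾_a(K)` induced by the Drinfeld module. -/
noncomputable def act (Φ : DrinfeldModule Fq K) (a : Polynomial Fq) (x : K) : K :=
  (Φ.toFun a).eval x

/-- `Φ` has rank `d ≥ 1`, i.e. `Φ_t = Σ_{i=0}^d a_i τ^i` with `a_d ≠ 0`. -/
def HasRank (Φ : DrinfeldModule Fq K) (d : ℕ) : Prop :=
  1 ≤ d ∧ (Φ.toFun Polynomial.X).natDegree = (Fintype.card Fq) ^ d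

/-- `x` is a torsion point for `Φ`. -/
def IsTorsion (Φ : DrinfeldModule Fq K) (x : K) : Prop :=
  ∃ Q : Polynomial Fq, Q ≠ 0 ∧ Φ.act Q x = 0

/-- `hv` is the local canonical height attached to `Φ` (of rank `d`) at the place `v`:
`ĥ_v(x) = lim_{n→∞} log max(|Φ_{t^n}(x)|_v, 1) / q^{nd}`. -/
def IsLocalHeight (Φ : DrinfeldModule Fq K) (d : ℕ) (v : AbsoluteValue K ℝ)
    (hv : K → ℝ) : Prop :=
  ∀ x : K, Tendsto
    (fun n : ℕ => Real.log (max (v (Φ.act (Polynomial.X ^ n) x)) 1) /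
      (Fintype.card Fq : ℝ) ^ (n * d)) atTop (𝓝 (hv x))

end DrinfeldModule

/-- The Weil height `h(x) = Σ_v log max(|x|_v, 1)`. -/
noncomputable def weilHeight {K : Type} [Field K] (P : PlaceFamily K) (x : K) : ℝ :=
  ∑ᶠ v : P.Places, Real.log (max (P.absv v x) 1)

/-- `hh` is the (global) canonical height attached to `Φ` of rank `d`:
`ĥ(x) = lim_{n→∞} h(Φ_{t^n}(x)) / q^{nd}`. -/
def DrinfeldModule.IsCanonicalHeight {Fq K : Type} [Field Fq] [Fintype Fq] [Field K]
    [Algebra (Polynomial Fq) K] (Φ : DrinfeldModule Fq K) (P : PlaceFamily K)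
    (d : ℕ) (hh : K → ℝ) : Prop :=
  ∀ x : K, Tendsto
    (fun n : ℕ => weilHeight P (Φ.act (Polynomial.X ^ n) x) /
      (Fintype.card Fq : ℝ) ^ (n * d)) atTop (𝓝 (hh x))

/-- `β` is `S`-integral with respect to `α`. -/
def SIntegral {K : Type} [Field K] (P : PlaceFamily K) (S : Set P.Places) (α β : K) : Prop :=
  ∀ v : P.Places, v ∉ S →
    (P.absv v α ≤ 1 → 1 ≤ P.absv v (α - β)) ∧
    (1 < P.absv v α → P.absv v β ≤ 1)

/-- `Γ` is a finitely generated `Φ`-submodule: it is generated, as an `A`-module under the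
action `a · x = Φ_a(x)`, by finitely many elements. -/
def DrinfeldModule.FinGen {Fq K : Type} [Field Fq] [Fintype Fq] [Field K]
    [Algebra (Polynomial Fq) K] (Φ : DrinfeldModule Fq K) (Γ : AddSubgroup K) : Prop :=
  ∃ s : Finset K, ∀ x : K, x ∈ Γ ↔ ∃ c : K → Polynomial Fq, x = ∑ g ∈ s, Φ.act (c g) g

open scoped Classical in
/-- `q^{d·deg P}`, with the convention that it equals `0` for the zero polynomial. -/
noncomputable def qdeg {Fq : Type} [Field Fq] [Fintype Fq] (d : ℕ) (P : Polynomial Fq) : ℝ :=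
  if P = 0 then 0 else (Fintype.card Fq : ℝ) ^ (d * P.natDegree)

/-- A monic polynomial over a nonarchimedean valued field behaves like its leading term outside a
large disc. -/
theorem Polynomial.Monic.exists_absoluteValue_eval_eq {K : Type*} [Field K]
    {v : AbsoluteValue K ℝ} (hna : IsNonarchimedean v) {F : K[X]} (hF : F.Monic) :
    ∃ R : ℝ, 1 ≤ R ∧ ∀ x : K, R < v x → v (F.eval x) = v x ^ F.natDegree := by
  refine ⟨∑ i ∈ Finset.range (F.natDegree + 1), v (F.coeff i), ?_, fun x hx => ?_⟩
  · rw [Finset.sum_range_succ, hF.coeff_natDegree, map_one]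
    exact le_add_of_nonneg_left (Finset.sum_nonneg fun i _ => v.nonneg _)
  have hcoeff : ∀ i ∈ Finset.range (F.natDegree + 1), v (F.coeff i) < v x := fun i hi =>
    (Finset.single_le_sum (f := fun i => v (F.coeff i)) (fun j _ => v.nonneg _) hi).trans_lt hx
  have hx1 : 1 < v x := by
    simpa [hF.coeff_natDegree] using hcoeff F.natDegree (Finset.self_mem_range_succ _)
  rw [eval_eq_sum_range, hna.apply_sum_eq_of_lt (fun a => (v.map_neg a).symm)
    (Finset.self_mem_range_succ F.natDegree)]
  · simp [hF.coeff_natDegree]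
  intro j hj hjne
  have hjlt : j + 1 ≤ F.natDegree := by
    have := Finset.mem_range.mp hj
    omega
  rw [hF.coeff_natDegree, one_mul, map_mul, map_pow, map_pow]
  calc v (F.coeff j) * v x ^ j < v x * v x ^ j :=
        mul_lt_mul_of_pos_right (hcoeff j hj) (by positivity)
    _ = v x ^ (j + 1) := (pow_succ' _ _).symm
    _ ≤ v x ^ F.natDegree := pow_le_pow_right₀ hx1.le hjlt

/-- An absolute value is trivial on the image of a finite field. -/
theorem AbsoluteValue.map_finite_field_eq_one {k K : Type*} [Field k] [Finite k] [Field K]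
    (v : AbsoluteValue K ℝ) (f : k →+* K) {c : k} (hc : c ≠ 0) : v (f c) = 1 := by
  have := Fintype.ofFinite k
  have hcard : Fintype.card k - 1 ≠ 0 := Nat.sub_ne_zero_of_lt Fintype.one_lt_card
  rw [← pow_eq_one_iff_of_nonneg (v.nonneg _) hcard, ← map_pow, ← map_pow,
    FiniteField.pow_card_sub_one_eq_one c hc, map_one, map_one]

namespace DrinfeldModule

variable {Fq K : Type} [Field Fq] [Fintype Fq] [Field K] [Algebra (Polynomial Fq) K]
  (Φ : DrinfeldModule Fq K)

theorem act_add (a b : Fq[X]) (x : K) : Φ.act (a + b) x = Φ.act a x + Φ.act b x := by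
  simp [act, Φ.map_add']

theorem act_mul (a b : Fq[X]) (x : K) : Φ.act (a * b) x = Φ.act a (Φ.act b x) := by
  simp [act, Φ.map_mul']

theorem act_C (c : Fq) (x : K) : Φ.act (C c) x = algebraMap Fq[X] K (C c) * x := by
  simp [act, Φ.map_C']

theorem act_one (x : K) : Φ.act 1 x = x := by
  simpa using Φ.act_C 1 x

theorem act_sum {ι : Type*} (s : Finset ι) (f : ι → Fq[X]) (x : K) :
    Φ.act (∑ i ∈ s, f i) x = ∑ i ∈ s, Φ.act (f i) x :=
  map_sum (AddMonoidHom.mk' (fun a => Φ.act a x) fun a b => Φ.act_add a b x) f s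

theorem act_eq_sum (P : Fq[X]) (x : K) :
    Φ.act P x = ∑ i ∈ Finset.range (P.natDegree + 1),
      algebraMap Fq[X] K (C (P.coeff i)) * Φ.act (X ^ i) x := by
  conv_lhs => rw [P.as_sum_range_C_mul_X_pow]
  simp_rw [act_sum, act_mul, act_C]

variable {Φ} {d : ℕ} {v : AbsoluteValue K ℝ} {hv : K → ℝ} {R : ℝ}

theorem map_const_mul {c : Fq} (hc : c ≠ 0) (y : K) :
    v (algebraMap Fq[X] K (C c) * y) = v y := by
  rw [map_mul, ← RingHom.comp_apply, v.map_finite_field_eq_one _ hc, one_mul]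

theorem map_const_mul_le (c : Fq) (y : K) : v (algebraMap Fq[X] K (C c) * y) ≤ v y := by
  rcases eq_or_ne c 0 with rfl | hc
  · simp
  · exact (map_const_mul hc y).le

theorem map_act_X_pow (hR : 1 ≤ R)
    (hesc : ∀ x, R < v x → v (Φ.act X x) = v x ^ (Fintype.card Fq ^ d))
    {x : K} (hx : R < v x) (n : ℕ) :
    v (Φ.act (X ^ n) x) = v x ^ (Fintype.card Fq ^ (n * d)) := by
  induction n with
  | zero => simp [act_one]
  | succ n ih =>
    have hlt : R < v (Φ.act (X ^ n) x) := by
      rw [ih]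
      exact hx.trans_le (le_self_pow₀ (hR.trans hx.le) (pow_pos Fintype.card_pos _).ne')
    rw [pow_succ', act_mul, hesc _ hlt, ih, ← pow_mul, ← pow_add, Nat.succ_mul]

theorem IsLocalHeight.log_map_act_X_pow (hloc : Φ.IsLocalHeight d v hv) (hR : 1 ≤ R)
    (hesc : ∀ x, R < v x → v (Φ.act X x) = v x ^ (Fintype.card Fq ^ d))
    {x : K} {j : ℕ} (hx : R < v (Φ.act (X ^ j) x)) :
    Real.log (v (Φ.act (X ^ j) x)) = (Fintype.card Fq : ℝ) ^ (j * d) * hv x := by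
  have hq : (0 : ℝ) < Fintype.card Fq := by exact_mod_cast Fintype.card_pos
  have hlim := (tendsto_add_atTop_iff_nat j).mpr (hloc x)
  have hconst : ∀ n : ℕ, Real.log (max (v (Φ.act (X ^ (n + j)) x)) 1) /
      (Fintype.card Fq : ℝ) ^ ((n + j) * d) =
      Real.log (v (Φ.act (X ^ j) x)) / (Fintype.card Fq : ℝ) ^ (j * d) := by
    intro n
    rw [pow_add X, act_mul, map_act_X_pow hR hesc hx,
      max_eq_left (one_le_pow₀ (hR.trans hx.le)), Real.log_pow, add_mul, pow_add]
    push_cast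
    field_simp
  simp_rw [hconst] at hlim
  rw [tendsto_nhds_unique hlim tendsto_const_nhds]
  field_simp

theorem IsLocalHeight.map_act_X_pow_eq_exp (hloc : Φ.IsLocalHeight d v hv) (hR : 1 ≤ R)
    (hesc : ∀ x, R < v x → v (Φ.act X x) = v x ^ (Fintype.card Fq ^ d))
    {x : K} {j : ℕ} (hx : R < v (Φ.act (X ^ j) x)) :
    v (Φ.act (X ^ j) x) = Real.exp ((Fintype.card Fq : ℝ) ^ (j * d) * hv x) := by
  rw [← hloc.log_map_act_X_pow hR hesc hx, Real.exp_log (by linarith)]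

theorem IsLocalHeight.exists_lt_map_act (hloc : Φ.IsLocalHeight d v hv) (hd : 1 ≤ d)
    {x : K} (hx : 0 < hv x) (hR : 1 ≤ R) : ∃ N, R < v (Φ.act (X ^ N) x) := by
  by_contra! hle
  have hq : (1 : ℝ) < Fintype.card Fq := by exact_mod_cast Fintype.one_lt_card
  have hpow : Tendsto (fun n : ℕ => (Fintype.card Fq : ℝ) ^ (n * d)) atTop atTop :=
    (tendsto_pow_atTop_atTop_of_one_lt hq).comp (tendsto_id.atTop_mul_const' hd)
  refine hx.not_ge (le_of_tendsto_of_tendsto' (hloc x)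
    (tendsto_const_nhds.div_atTop hpow : Tendsto (fun n : ℕ => Real.log R / _) atTop _)
    fun n => ?_)
  gcongr
  exact max_le (hle n) hR

theorem lt_map_act_of_le (hR : 1 ≤ R)
    (hesc : ∀ x, R < v x → v (Φ.act X x) = v x ^ (Fintype.card Fq ^ d))
    {x : K} {N n : ℕ} (hx : R < v (Φ.act (X ^ N) x)) (hn : N ≤ n) :
    R < v (Φ.act (X ^ n) x) := by
  rw [← Nat.sub_add_cancel hn, pow_add, act_mul, map_act_X_pow hR hesc hx]
  exact hx.trans_le (le_self_pow₀ (hR.trans hx.le) (pow_pos Fintype.card_pos _).ne')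

/-- For a point of positive local height, the top-degree term dominates `Φ_P(x)`. -/
theorem IsLocalHeight.map_act_eq_exp (hloc : Φ.IsLocalHeight d v hv) (hna : IsNonarchimedean v)
    (hd : 1 ≤ d) (hR : 1 ≤ R)
    (hesc : ∀ x, R < v x → v (Φ.act X x) = v x ^ (Fintype.card Fq ^ d))
    {x : K} (hpos : 0 < hv x) {P : Fq[X]} (hP : P ≠ 0)
    (hx : R < v (Φ.act (X ^ P.natDegree) x)) :
    v (Φ.act P x) = Real.exp ((Fintype.card Fq : ℝ) ^ (P.natDegree * d) * hv x) := by
  have hq : (1 : ℝ) < Fintype.card Fq := by exact_mod_cast Fintype.one_lt_card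
  have hlead : v (algebraMap Fq[X] K (C (P.coeff P.natDegree)) * Φ.act (X ^ P.natDegree) x) =
      v (Φ.act (X ^ P.natDegree) x) :=
    map_const_mul (leadingCoeff_ne_zero.mpr hP) _
  rw [act_eq_sum, hna.apply_sum_eq_of_lt (fun a => (v.map_neg a).symm)
    (Finset.self_mem_range_succ P.natDegree), hlead, hloc.map_act_X_pow_eq_exp hR hesc hx]
  intro j hj hjne
  have hjlt : j < P.natDegree := by
    have := Finset.mem_range.mp hj
    omega
  rw [hlead]
  refine (map_const_mul_le _ _).trans_lt ?_
  rcases le_or_gt (v (Φ.act (X ^ j) x)) R with h | h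
  · exact h.trans_lt hx
  · rw [hloc.map_act_X_pow_eq_exp hR hesc h, hloc.map_act_X_pow_eq_exp hR hesc hx]
    have : j * d < P.natDegree * d := Nat.mul_lt_mul_of_pos_right hjlt hd
    gcongr

/-- An upper bound for `|Φ_P(x)|_v` in terms of a bound on the local height of `x`. -/
theorem IsLocalHeight.map_act_lt (hloc : Φ.IsLocalHeight d v hv) (hna : IsNonarchimedean v)
    (hR : 1 ≤ R) (hesc : ∀ x, R < v x → v (Φ.act X x) = v x ^ (Fintype.card Fq ^ d))
    {x : K} {h : ℝ} (hpos : 0 < h) (hx : hv x / (Fintype.card Fq : ℝ) ^ d < h)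
    {P : Fq[X]} {m : ℕ} (hP : P.natDegree < m)
    (hRm : R < Real.exp ((Fintype.card Fq : ℝ) ^ (m * d) * h)) :
    v (Φ.act P x) < Real.exp ((Fintype.card Fq : ℝ) ^ (m * d) * h) := by
  have hq : (1 : ℝ) < Fintype.card Fq := by exact_mod_cast Fintype.one_lt_card
  rw [act_eq_sum]
  obtain ⟨j, hj, hle⟩ := hna.finset_image_add_of_nonempty
    (fun i => algebraMap Fq[X] K (C (P.coeff i)) * Φ.act (X ^ i) x)
    (Finset.nonempty_range_add_one (n := P.natDegree))
  refine (hle.trans (map_const_mul_le _ _)).trans_lt ?_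
  rcases le_or_gt (v (Φ.act (X ^ j) x)) R with hj' | hj'
  · exact hj'.trans_lt hRm
  have hjm : (j + 1) * d ≤ m * d :=
    Nat.mul_le_mul_right d (by have := Finset.mem_range.mp hj; omega)
  rw [hloc.map_act_X_pow_eq_exp hR hesc hj', Real.exp_lt_exp]
  calc (Fintype.card Fq : ℝ) ^ (j * d) * hv x
      < (Fintype.card Fq : ℝ) ^ (j * d) * (h * (Fintype.card Fq : ℝ) ^ d) := by
        gcongr
        rwa [div_lt_iff₀ (by positivity)] at hx
    _ = (Fintype.card Fq : ℝ) ^ ((j + 1) * d) * h := by ring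
    _ ≤ (Fintype.card Fq : ℝ) ^ (m * d) * h := by
        gcongr
        exact hq.le

end DrinfeldModule

/-- **Lemma (leading term of a local canonical height).** Let `γ_1, …, γ_r ∈ K` (indexed here
by `Fin r`, with `γ_1` corresponding to the index `0`) and let `v` be a place of `K`. Assume
`ĥ_v(γ_1) > q^{-d}·max_{i>1} ĥ_v(γ_i)` (in particular `ĥ_v(γ_1) > 0`). Then there exist
`n_0 ∈ ℕ` and a positive real `c_1` such that for all nonzero `P_1, …, P_r ∈ 𝔽_q[t]` with
`deg P_1 > max_{i>1} deg P_i`, `min_{i>1} deg P_i ≥ n_0` and `deg P_1 ≥ n_0`, one has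
`log|Φ_{P_1}(γ_1) + ⋯ + Φ_{P_r}(γ_r)|_v > c_1 · q^{d·(deg P_1 − n_0)}`. -/
theorem local_height_leading_term
    {Fq K : Type} [Field Fq] [Fintype Fq] [Field K]
    [Algebra (Polynomial Fq) K] [Algebra (RatFunc Fq) K]
    [IsScalarTower (Polynomial Fq) (RatFunc Fq) K] [FiniteDimensional (RatFunc Fq) K]
    (Φ : DrinfeldModule Fq K) (d : ℕ) (hrank : Φ.HasRank d)
    (hmonic : (Φ.toFun Polynomial.X).Monic)
    (v : AbsoluteValue K ℝ) (hnonarch : ∀ x y : K, v (x + y) ≤ max (v x) (v y))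
    (hv : K → ℝ) (hloc : Φ.IsLocalHeight d v hv)
    (r : ℕ) (hr : 1 ≤ r) (γ : Fin r → K)
    (hpos : 0 < hv (γ ⟨0, hr⟩))
    (hmax : ∀ i : Fin r, 0 < (i : ℕ) →
      hv (γ i) / (Fintype.card Fq : ℝ) ^ d < hv (γ ⟨0, hr⟩)) :
    ∃ n₀ : ℕ, ∃ c₁ : ℝ, 0 < c₁ ∧
      ∀ Pp : Fin r → Polynomial Fq, (∀ i, Pp i ≠ 0) →
        (∀ i : Fin r, 0 < (i : ℕ) → (Pp i).natDegree < (Pp ⟨0, hr⟩).natDegree) →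
        (∀ i : Fin r, n₀ ≤ (Pp i).natDegree) →
        c₁ * (Fintype.card Fq : ℝ) ^ (d * ((Pp ⟨0, hr⟩).natDegree - n₀)) <
          Real.log (v (∑ i, Φ.act (Pp i) (γ i))) := by
  have hna : IsNonarchimedean v := hnonarch
  have hq : (1 : ℝ) < Fintype.card Fq := by exact_mod_cast Fintype.one_lt_card
  obtain ⟨R, hR, hesc⟩ := hmonic.exists_absoluteValue_eval_eq hna
  rw [hrank.2] at hesc
  obtain ⟨N, hN⟩ := hloc.exists_lt_map_act hrank.1 hpos hR
  refine ⟨N, hv (γ ⟨0, hr⟩) / 2, by positivity, fun Pp hne hdeg hmin => ?_⟩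
  have hlt := DrinfeldModule.lt_map_act_of_le hR hesc hN (hmin ⟨0, hr⟩)
  have hlead := hloc.map_act_eq_exp hna hrank.1 hR hesc hpos (hne ⟨0, hr⟩) hlt
  have hRexp := hloc.map_act_X_pow_eq_exp hR hesc hlt ▸ hlt
  rw [hna.apply_sum_eq_of_lt (fun a => (v.map_neg a).symm) (Finset.mem_univ ⟨0, hr⟩), hlead,
    Real.log_exp, mul_comm]
  · have hexp : d * ((Pp ⟨0, hr⟩).natDegree - N) ≤ (Pp ⟨0, hr⟩).natDegree * d := by
      rw [mul_comm]
      exact Nat.mul_le_mul_right d (Nat.sub_le _ _)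
    exact mul_lt_mul' (pow_le_pow_right₀ hq.le hexp) (half_lt_self hpos) (by positivity)
      (by positivity)
  · intro j _ hj
    have hj0 : 0 < (j : ℕ) := Nat.pos_of_ne_zero fun h => hj (Fin.ext h)
    rw [hlead]
    exact hloc.map_act_lt hna hR hesc hpos (hmax j hj0) (hdeg j hj0) hRexp
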